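/- arXiv:2508.02582 — 4 statements merged into one kernel-verified Lean document; each statement's English description precedes it below -/
import Mathlib

section
/- Assume every vertex of Γ has out-degree at least 1 and every vertex of out-degree 1 has its unique outgoing edge a loop. Then a point (i, α) of Shift(Γ|Y) is an isolated point of the topological space Shift(Γ|Y) if and only if there exist n₀ ∈ ℕ, a vertex x ∈ VΓ, and an edge e with init⁻¹(x) = {e} and init(e) = term(e) = x, such that α(m) = e for all m ≥ n₀; that is, the isolated points are exactly the points of the form p x^∞, a finite prefix p followed by infinitely many repetitions of the unique loop at a vertex x of out-degree 1. -/
/-- The edge shift `Shift(Γ|Y)`: pairs `(i, α)` of a start index and an infinite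
sequence of edges forming a path starting at the vertex `ι i`. -/
def shiftSet {V E I : Type*} (init term : E → V) (ι : I → V) :
    Set (I × (ℕ → E)) :=
  {x | init (x.2 0) = ι x.1 ∧ ∀ n, term (x.2 n) = init (x.2 (n + 1))}

/-- Membership of a finite word `w = (i, e₁ ⋯ e_k)` in the language `Lang(Γ|Y)`. -/
def inLang {V E I : Type*} (init term : E → V) (ι : I → V)
    (w : I × List E) : Prop :=
  (∀ h : w.2 ≠ [], init (w.2.head h) = ι w.1) ∧
    w.2.Chain' fun e f => term e = init f

/-- The color (terminal vertex) of a finite word: `term` of the last edge,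
or `ι i` for the empty word. -/
def langColor {V E I : Type*} (term : E → V) (ι : I → V)
    (w : I × List E) : V :=
  w.2.getLast?.elim (ι w.1) term

/-- The cylinder `C_w`: elements of the edge shift having `w` as a prefix. -/
def cylinder {V E I : Type*} (init term : E → V) (ι : I → V)
    (w : I × List E) : Set (I × (ℕ → E)) :=
  {x | x ∈ shiftSet init term ι ∧ x.1 = w.1 ∧
    ∀ j : Fin w.2.length, x.2 j.1 = w.2.get j}

/-- The cylinder `C_w`, viewed as a subset of the edge shift. -/
def cylSub {V E I : Type*} (init term : E → V) (ι : I → V)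
    (w : I × List E) : Set ↥(shiftSet init term ι) :=
  {x | (x : I × (ℕ → E)) ∈ cylinder init term ι w}

/-- The topology on `Shift(Γ|Y)` generated by the cylinders. -/
instance shiftTopology {V E I : Type*} (init term : E → V) (ι : I → V) :
    TopologicalSpace ↥(shiftSet init term ι) :=
  TopologicalSpace.generateFrom
    {s | ∃ w, inLang init term ι w ∧ s = cylSub init term ι w}

/-- An open set of the edge shift contains, with a point, every point sharing
a sufficiently long prefix with it. -/
theorem exists_prefix_subset_of_isOpen {V E I : Type*} {init term : E → V} {ι : I → V}
    {s : Set ↥(shiftSet init term ι)} (hs : IsOpen s) {x : ↥(shiftSet init term ι)}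
    (hx : x ∈ s) :
    ∃ N : ℕ, ∀ y : ↥(shiftSet init term ι),
      y.1.1 = x.1.1 → (∀ j < N, y.1.2 j = x.1.2 j) → y ∈ s := by
  change TopologicalSpace.GenerateOpen _ s at hs
  induction hs with
  | basic s hs =>
    obtain ⟨w, -, rfl⟩ := hs
    obtain ⟨-, hx₁, hx₂⟩ := hx
    exact ⟨w.2.length, fun y hy₁ hy₂ =>
      ⟨y.2, hy₁.trans hx₁, fun j => (hy₂ j j.2).trans (hx₂ j)⟩⟩
  | univ => exact ⟨0, fun _ _ _ => trivial⟩
  | inter s t _ _ ihs iht =>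
    obtain ⟨M, hM⟩ := ihs hx.1
    obtain ⟨N, hN⟩ := iht hx.2
    exact ⟨max M N, fun y hy₁ hy₂ =>
      ⟨hM y hy₁ fun j hj => hy₂ j (lt_max_of_lt_left hj),
        hN y hy₁ fun j hj => hy₂ j (lt_max_of_lt_right hj)⟩⟩
  | sUnion S _ ih =>
    obtain ⟨t, ht, hxt⟩ := hx
    obtain ⟨N, hN⟩ := ih t ht hxt
    exact ⟨N, fun y hy₁ hy₂ => ⟨t, ht, hN y hy₁ hy₂⟩⟩

/-- The set of points sharing the prefix of length `N` of a given point is open. -/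
theorem isOpen_setOf_prefix_eq {V E I : Type*} {init term : E → V} {ι : I → V}
    (x : ↥(shiftSet init term ι)) (N : ℕ) :
    IsOpen {y : ↥(shiftSet init term ι) |
      y.1.1 = x.1.1 ∧ ∀ j < N, y.1.2 j = x.1.2 j} := by
  refine TopologicalSpace.isOpen_generateFrom_of_mem
    ⟨(x.1.1, List.ofFn fun j : Fin N => x.1.2 j), ⟨fun h => ?_, ?_⟩, ?_⟩
  · simpa [List.head_ofFn] using x.2.1
  · refine List.isChain_iff_getElem.2 fun j hj => ?_
    simpa using x.2.2 j
  · ext y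
    constructor
    · rintro ⟨h₁, h₂⟩
      refine ⟨y.2, h₁, fun j => ?_⟩
      simpa using h₂ j (by simpa using j.2)
    · rintro ⟨-, h₁, h₂⟩
      refine ⟨h₁, fun j hj => ?_⟩
      simpa using h₂ ⟨j, by simpa using hj⟩

/-- If every vertex has an outgoing edge, any prefix of a point followed by a
compatible edge extends to a point of the edge shift. -/
theorem exists_prefix_eq_and_apply_eq {V E I : Type*} {init term : E → V} {ι : I → V}
    (hsur : ∀ v : V, ∃ e, init e = v) (x : ↥(shiftSet init term ι)) (N : ℕ) {f : E}
    (hf : init f = init (x.1.2 N)) :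
    ∃ y : ↥(shiftSet init term ι),
      y.1.1 = x.1.1 ∧ (∀ j < N, y.1.2 j = x.1.2 j) ∧ y.1.2 N = f := by
  choose g hg using hsur
  let β : ℕ → E := fun n => if n < N then x.1.2 n else (fun e => g (term e))^[n - N] f
  have hlt : ∀ n < N, β n = x.1.2 n := fun n hn => if_pos hn
  have hN : β N = f := by simp [β]
  have hinit : ∀ n ≤ N, init (β n) = init (x.1.2 n) := fun n hn => by
    rcases hn.lt_or_eq with h | rfl
    · rw [hlt n h]
    · rw [hN, hf]
  refine ⟨⟨(x.1.1, β), (hinit 0 N.zero_le).trans x.2.1, fun n => ?_⟩, rfl, hlt, hN⟩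
  change term (β n) = init (β (n + 1))
  rcases lt_or_ge n N with h | h
  · rw [hlt n h, hinit (n + 1) h, x.2.2 n]
  · have hsucc : β (n + 1) = g (term (β n)) := by
      simp only [β, if_neg h.not_gt, if_neg (h.trans n.le_succ).not_gt,
        Nat.succ_sub h, Function.iterate_succ_apply']
    rw [hsucc, hg]

/-- Once a point of the edge shift traverses the only edge out of a vertex and this
edge is a loop, it repeats that edge forever. -/
theorem apply_eq_of_unique_loop {V E I : Type*} {init term : E → V} {ι : I → V}
    (x : ↥(shiftSet init term ι)) {v : V} {e : E} (he : init ⁻¹' {v} = {e})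
    (hterm : term e = v) {N : ℕ} (hN : x.1.2 N = e) {m : ℕ} (hm : N ≤ m) :
    x.1.2 m = e := by
  induction m, hm using Nat.le_induction with
  | base => exact hN
  | succ m _ ih =>
    have hmem : x.1.2 (m + 1) ∈ init ⁻¹' {v} := by
      change init _ = v
      rw [← x.2.2 m, ih, hterm]
    rwa [he] at hmem

/-- Assume every vertex of `Γ` has out-degree at least `1`
and every vertex of out-degree `1` has its unique outgoing edge a loop.  Then
a point of `Shift(Γ|Y)` is isolated if and only if its sequence of edges is
eventually the constant repetition of the unique loop `e` at some vertex `v`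
of out-degree `1`. -/
theorem isolated_iff_eventually_loop
    {V E I : Type*} [Finite V] [Finite E] [Finite I]
    (init term : E → V) (ι : I → V)
    (hsur : ∀ v : V, ∃ e, init e = v)
    (hloop : ∀ (v : V) (e : E), init ⁻¹' {v} = {e} → term e = v)
    (x : ↥(shiftSet init term ι)) :
    IsOpen ({x} : Set ↥(shiftSet init term ι)) ↔
      ∃ (n₀ : ℕ) (v : V) (e : E),
        init ⁻¹' {v} = {e} ∧ init e = v ∧ term e = v ∧
        ∀ m, n₀ ≤ m → (x : I × (ℕ → E)).2 m = e := by
  constructor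
  · intro hopen
    obtain ⟨N, hN⟩ := exists_prefix_subset_of_isOpen hopen rfl
    have he : init ⁻¹' {init (x.1.2 N)} = {x.1.2 N} := by
      refine Set.Subset.antisymm (fun f hf => ?_) (Set.singleton_subset_iff.2 rfl)
      obtain ⟨y, hy₁, hy₂, rfl⟩ := exists_prefix_eq_and_apply_eq hsur x N hf
      rw [hN y hy₁ hy₂]
      rfl
    have hterm := hloop _ _ he
    exact ⟨N, _, _, he, rfl, hterm, fun m hm => apply_eq_of_unique_loop x he hterm rfl hm⟩
  · rintro ⟨N, v, e, he, -, hterm, hx⟩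
    convert isOpen_setOf_prefix_eq x (N + 1) using 1
    refine Set.Subset.antisymm (Set.singleton_subset_iff.2 ⟨rfl, fun _ _ => rfl⟩) ?_
    rintro y ⟨hy₁, hy₂⟩
    refine Subtype.ext (Prod.ext hy₁ (funext fun m => ?_))
    rcases lt_or_ge m N with h | h
    · exact hy₂ m (h.trans N.lt_succ_self)
    · rw [hx m h]
      exact apply_eq_of_unique_loop y he hterm ((hy₂ N N.lt_succ_self).trans (hx N le_rfl)) h
end

section
/- The set of all piecewise-canonical homeomorphisms of Shift(Γ|Y) forms a subgroup of the group of homeomorphisms of Shift(Γ|Y): the identity is piecewise-canonical, the composition of two piecewise-canonical homeomorphisms is piecewise-canonical, and the inverse of a piecewise-canonical homeomorphism is piecewise-canonical. -/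
/-- The canonical map `Φ_{p,q}` replacing the prefix `p` by `q` and keeping
the tail of edges. -/
def replacePrefix {E I : Type*} (p q : I × List E) (x : I × (ℕ → E)) :
    I × (ℕ → E) :=
  (q.1, fun n =>
    if h : n < q.2.length then q.2.get ⟨n, h⟩
    else x.2 (n - q.2.length + p.2.length))

/-- A homeomorphism of `Shift(Γ|Y)` is piecewise-canonical if there are finite
partitions `{C_{w i}}` and `{C_{v i}}` of `Shift(Γ|Y)` into cylinders, with
`w i` and `v i` of the same color, such that the map restricts to the
canonical homeomorphism `Φ_{w i, v i}` on each `C_{w i}`. -/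
def IsPiecewiseCanonical {V E I : Type*} (init term : E → V) (ι : I → V)
    (φ : ↥(shiftSet init term ι) ≃ₜ ↥(shiftSet init term ι)) : Prop :=
  ∃ (k : ℕ) (w v : Fin k → I × List E),
    (∀ i, inLang init term ι (w i)) ∧ (∀ i, inLang init term ι (v i)) ∧
    (⋃ i, cylinder init term ι (w i)) = shiftSet init term ι ∧
    (∀ i i', i ≠ i' →
      cylinder init term ι (w i) ∩ cylinder init term ι (w i') = ∅) ∧
    (⋃ i, cylinder init term ι (v i)) = shiftSet init term ι ∧
    (∀ i i', i ≠ i' →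
      cylinder init term ι (v i) ∩ cylinder init term ι (v i') = ∅) ∧
    (∀ i, langColor term ι (w i) = langColor term ι (v i)) ∧
    ∀ i (x : ↥(shiftSet init term ι)),
      (x : I × (ℕ → E)) ∈ cylinder init term ι (w i) →
        ((φ x : ↥(shiftSet init term ι)) : I × (ℕ → E)) =
          replacePrefix (w i) (v i) (x : I × (ℕ → E))

namespace EdgeShift

variable {V E I : Type*} {init term : E → V} {ι : I → V}

/-- Two points of `I × (ℕ → E)` have the same start index and the same first `m` edges. -/
def Agree (m : ℕ) (x y : I × (ℕ → E)) : Prop :=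
  x.1 = y.1 ∧ ∀ n < m, x.2 n = y.2 n

/-- The word consisting of the start index and the first `m` edges of `x`. -/
def initialWord (x : I × (ℕ → E)) (m : ℕ) : I × List E :=
  (x.1, (List.range m).map x.2)

@[simp]
theorem length_initialWord (x : I × (ℕ → E)) (m : ℕ) : (initialWord x m).2.length = m := by
  simp [initialWord]

theorem mem_cylinder_iff {w : I × List E} (x : shiftSet init term ι) :
    (x : I × (ℕ → E)) ∈ cylinder init term ι w ↔
      x.1.1 = w.1 ∧ ∀ n (h : n < w.2.length), x.1.2 n = w.2[n] := by
  constructor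
  · rintro ⟨-, h, h'⟩
    exact ⟨h, fun n hn => h' ⟨n, hn⟩⟩
  · rintro ⟨h, h'⟩
    exact ⟨x.2, h, fun j => h' j.1 j.2⟩

theorem mem_cylinder_initialWord (x y : shiftSet init term ι) (m : ℕ) :
    (x : I × (ℕ → E)) ∈ cylinder init term ι (initialWord y.1 m) ↔ Agree m x.1 y.1 := by
  simp [mem_cylinder_iff, initialWord, Agree]

theorem mem_cylinder_iff_agree {w : I × List E} {z : shiftSet init term ι}
    (hz : (z : I × (ℕ → E)) ∈ cylinder init term ι w) (x : shiftSet init term ι) :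
    (x : I × (ℕ → E)) ∈ cylinder init term ι w ↔ Agree w.2.length x.1 z.1 := by
  rw [mem_cylinder_iff] at hz ⊢
  unfold Agree
  grind

theorem agree_max_iff {v w : I × List E} {z : shiftSet init term ι}
    (hv : (z : I × (ℕ → E)) ∈ cylinder init term ι v)
    (hw : (z : I × (ℕ → E)) ∈ cylinder init term ι w) (x : shiftSet init term ι) :
    Agree (max v.2.length w.2.length) x.1 z.1 ↔
      (x : I × (ℕ → E)) ∈ cylinder init term ι v ∧
        (x : I × (ℕ → E)) ∈ cylinder init term ι w := by
  rw [mem_cylinder_iff_agree hv, mem_cylinder_iff_agree hw]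
  unfold Agree
  grind

theorem inLang_of_mem_cylinder {w : I × List E} {x : I × (ℕ → E)}
    (hx : x ∈ cylinder init term ι w) : inLang init term ι w := by
  obtain ⟨⟨h0, hs⟩, h1, h2⟩ := hx
  have h2' : ∀ n (h : n < w.2.length), w.2[n] = x.2 n := fun n hn => (h2 ⟨n, hn⟩).symm
  refine ⟨fun h => ?_, ?_⟩
  · rw [List.head_eq_getElem, h2', h0, h1]
  · refine List.isChain_iff_getElem.2 fun n hn => ?_
    rw [h2', h2', hs]

theorem langColor_of_mem_cylinder {w : I × List E} {x : I × (ℕ → E)}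
    (hx : x ∈ cylinder init term ι w) : langColor term ι w = init (x.2 w.2.length) := by
  obtain ⟨⟨h0, hs⟩, h1, h2⟩ := hx
  have h2' : ∀ n (h : n < w.2.length), w.2[n] = x.2 n := fun n hn => (h2 ⟨n, hn⟩).symm
  unfold langColor
  rcases Nat.eq_zero_or_pos w.2.length with h | h
  · rw [h, List.length_eq_zero_iff.1 h, h0, h1]
    rfl
  · rw [List.getLast?_eq_getElem?, List.getElem?_eq_getElem (by omega), h2', Option.elim_some, hs,
      Nat.sub_add_cancel h]

theorem replacePrefix_mem_cylinder {p q : I × List E} {x : I × (ℕ → E)}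
    (h : replacePrefix p q x ∈ shiftSet init term ι) :
    replacePrefix p q x ∈ cylinder init term ι q :=
  ⟨h, rfl, fun j => by simp [replacePrefix]⟩

theorem replacePrefix_apply_add (p q : I × List E) (x : I × (ℕ → E)) (n : ℕ) :
    (replacePrefix p q x).2 (q.2.length + n) = x.2 (p.2.length + n) := by
  simp [replacePrefix, Nat.add_comm]

theorem eq_replacePrefix {p q : I × List E} {x y : I × (ℕ → E)}
    (hy : y ∈ cylinder init term ι q)
    (h : ∀ n, y.2 (q.2.length + n) = x.2 (p.2.length + n)) : y = replacePrefix p q x := by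
  refine Prod.ext hy.2.1 (funext fun n => ?_)
  by_cases hn : n < q.2.length
  · simpa [replacePrefix, hn] using hy.2.2 ⟨n, hn⟩
  · obtain ⟨m, rfl⟩ := Nat.exists_eq_add_of_le (not_lt.1 hn)
    rw [h, replacePrefix_apply_add]

/-- The cylinders `C_{w i}` partition the edge shift, and `φ` maps each `C_{w i}` onto `C_{v i}`,
preserving the tails of edge sequences. -/
structure IsCanonicalOn {κ : Type*} (φ : shiftSet init term ι ≃ₜ shiftSet init term ι)
    (w v : κ → I × List E) : Prop where
  existsUnique : ∀ x : shiftSet init term ι, ∃! i, x.1 ∈ cylinder init term ι (w i)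
  mem_iff : ∀ i (x : shiftSet init term ι),
    x.1 ∈ cylinder init term ι (w i) ↔ (φ x).1 ∈ cylinder init term ι (v i)
  tail : ∀ i (x : shiftSet init term ι), x.1 ∈ cylinder init term ι (w i) →
    ∀ n, (φ x).1.2 ((v i).2.length + n) = x.1.2 ((w i).2.length + n)

namespace IsCanonicalOn

variable {κ μ : Type*} {φ ψ : shiftSet init term ι ≃ₜ shiftSet init term ι}
  {w v : κ → I × List E} {w' v' : μ → I × List E}

theorem symm (h : IsCanonicalOn φ w v) : IsCanonicalOn φ.symm v w where
  existsUnique x := by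
    have := h.existsUnique (φ.symm x)
    simpa only [h.mem_iff, φ.apply_symm_apply] using this
  mem_iff i x := by rw [h.mem_iff, φ.apply_symm_apply]
  tail i x hx n := by
    have := h.tail i (φ.symm x) (by rwa [h.mem_iff, φ.apply_symm_apply]) n
    rw [φ.apply_symm_apply] at this
    exact this.symm

theorem agree_of_agree (h : IsCanonicalOn φ w v) {i : κ} {z : shiftSet init term ι}
    (hz : z.1 ∈ cylinder init term ι (w i)) {k : ℕ} {y : shiftSet init term ι}
    (hy : Agree ((w i).2.length + k) y.1 z.1) :
    Agree ((v i).2.length + k) (φ y).1 (φ z).1 := by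
  have hy' : y.1 ∈ cylinder init term ι (w i) :=
    (mem_cylinder_iff_agree hz y).2 ⟨hy.1, fun n hn => hy.2 n (by omega)⟩
  obtain ⟨hι, hlt⟩ :=
    (mem_cylinder_iff_agree ((h.mem_iff i z).1 hz) (φ y)).1 ((h.mem_iff i y).1 hy')
  refine ⟨hι, fun n hn => ?_⟩
  rcases lt_or_ge n (v i).2.length with hn' | hn'
  · exact hlt n hn'
  · obtain ⟨m, rfl⟩ := Nat.exists_eq_add_of_le hn'
    rw [h.tail i y hy', h.tail i z hz]
    exact hy.2 _ (by omega)

theorem agree_iff (h : IsCanonicalOn φ w v) {i : κ} {z : shiftSet init term ι}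
    (hz : z.1 ∈ cylinder init term ι (w i)) (k : ℕ) (y : shiftSet init term ι) :
    Agree ((w i).2.length + k) y.1 z.1 ↔ Agree ((v i).2.length + k) (φ y).1 (φ z).1 := by
  refine ⟨h.agree_of_agree hz, fun hy => ?_⟩
  simpa only [φ.symm_apply_apply] using h.symm.agree_of_agree ((h.mem_iff i z).1 hz) hy

theorem isPiecewiseCanonical [Finite κ] (h : IsCanonicalOn φ w v) :
    IsPiecewiseCanonical init term ι φ := by
  let κ' := {i : κ // ∃ x : shiftSet init term ι, x.1 ∈ cylinder init term ι (w i)}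
  obtain ⟨k, ⟨e⟩⟩ := Finite.exists_equiv_fin κ'
  have cover : ∀ {φ : shiftSet init term ι ≃ₜ shiftSet init term ι} {w v : κ → I × List E},
      IsCanonicalOn φ w v →
      (∀ i (x : shiftSet init term ι), x.1 ∈ cylinder init term ι (w i) → ∃ a, (e.symm a).1 = i) →
      ⋃ a, cylinder init term ι (w (e.symm a).1) = shiftSet init term ι := by
    intro φ w v h hne
    refine Set.Subset.antisymm (Set.iUnion_subset fun a x hx => hx.1) fun x hx => ?_
    obtain ⟨i, hi, -⟩ := h.existsUnique ⟨x, hx⟩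
    obtain ⟨a, rfl⟩ := hne i ⟨x, hx⟩ hi
    exact Set.mem_iUnion.2 ⟨a, hi⟩
  have disjoint : ∀ {φ : shiftSet init term ι ≃ₜ shiftSet init term ι} {w v : κ → I × List E},
      IsCanonicalOn φ w v → ∀ a b, a ≠ b →
      cylinder init term ι (w (e.symm a).1) ∩ cylinder init term ι (w (e.symm b).1) = ∅ := by
    intro φ w v h a b hab
    refine Set.eq_empty_of_forall_notMem fun x hx => hab ?_
    exact e.symm.injective
      (Subtype.ext ((h.existsUnique ⟨x, hx.1.1⟩).unique hx.1 hx.2))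
  refine ⟨k, fun a => w (e.symm a).1, fun a => v (e.symm a).1, fun a => ?_, fun a => ?_,
    cover h fun i x hx => ⟨e ⟨i, x, hx⟩, by simp⟩, disjoint h,
    cover h.symm fun i x hx => ⟨e ⟨i, φ.symm x, (h.symm.mem_iff i x).1 hx⟩, by simp⟩,
    disjoint h.symm, fun a => ?_, fun a x hx => ?_⟩
  · obtain ⟨x, hx⟩ := (e.symm a).2
    exact inLang_of_mem_cylinder hx
  · obtain ⟨x, hx⟩ := (e.symm a).2
    exact inLang_of_mem_cylinder ((h.mem_iff _ x).1 hx)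
  · obtain ⟨x, hx⟩ := (e.symm a).2
    rw [langColor_of_mem_cylinder hx, langColor_of_mem_cylinder ((h.mem_iff _ x).1 hx)]
    exact congrArg init (h.tail _ x hx 0).symm
  · exact eq_replacePrefix ((h.mem_iff _ x).1 hx) (h.tail _ x hx)

theorem refl : IsCanonicalOn (Homeomorph.refl (shiftSet init term ι))
    (fun i : I => (i, [])) (fun i : I => (i, [])) where
  existsUnique x := by simp [mem_cylinder_iff]
  mem_iff _ _ := Iff.rfl
  tail _ _ _ _ := rfl

theorem trans_isPiecewiseCanonical [Finite κ] [Finite μ] (h : IsCanonicalOn φ w v)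
    (h' : IsCanonicalOn ψ w' v') : IsPiecewiseCanonical init term ι (φ.trans ψ) := by
  let ρ := {p : κ × μ // ∃ z : shiftSet init term ι,
    z.1 ∈ cylinder init term ι (v p.1) ∧ z.1 ∈ cylinder init term ι (w' p.2)}
  choose z hzv hzw using fun p : ρ => p.2
  let m (p : ρ) := max (v p.1.1).2.length (w' p.1.2).2.length
  let a (p : ρ) := (w p.1.1).2.length + (m p - (v p.1.1).2.length)
  let b (p : ρ) := (v' p.1.2).2.length + (m p - (w' p.1.2).2.length)
  have hmv (p : ρ) : (v p.1.1).2.length + (m p - (v p.1.1).2.length) = m p :=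
    Nat.add_sub_cancel' (le_max_left _ _)
  have hmw (p : ρ) : (w' p.1.2).2.length + (m p - (w' p.1.2).2.length) = m p :=
    Nat.add_sub_cancel' (le_max_right _ _)
  have source (p : ρ) (x : shiftSet init term ι) :
      x.1 ∈ cylinder init term ι (initialWord (φ.symm (z p)).1 (a p)) ↔
        Agree (m p) (φ x).1 (z p).1 := by
    have := h.symm.agree_iff (hzv p) (m p - (v p.1.1).2.length) (φ x)
    rw [hmv, φ.symm_apply_apply] at this
    rw [mem_cylinder_initialWord, this]
  have target (p : ρ) (x : shiftSet init term ι) :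
      (ψ x).1 ∈ cylinder init term ι (initialWord (ψ (z p)).1 (b p)) ↔
        Agree (m p) x.1 (z p).1 := by
    have := h'.agree_iff (hzw p) (m p - (w' p.1.2).2.length) x
    rw [hmw] at this
    rw [mem_cylinder_initialWord, this]
  have middle (p : ρ) (x : shiftSet init term ι) := agree_max_iff (hzv p) (hzw p) x
  refine IsCanonicalOn.isPiecewiseCanonical
    (w := fun p : ρ => initialWord (φ.symm (z p)).1 (a p))
    (v := fun p : ρ => initialWord (ψ (z p)).1 (b p))
    ⟨fun x => ?_, fun p x => ?_, fun p x hx n => ?_⟩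
  · obtain ⟨i, hi, hi'⟩ := h.symm.existsUnique (φ x)
    obtain ⟨j, hj, hj'⟩ := h'.existsUnique (φ x)
    refine ⟨⟨(i, j), φ x, hi, hj⟩, (source _ x).2 ((middle _ _).2 ⟨hi, hj⟩), fun p hp => ?_⟩
    obtain ⟨hv, hw⟩ := (middle _ _).1 ((source p x).1 hp)
    exact Subtype.ext (Prod.ext (hi' _ hv) (hj' _ hw))
  · rw [source, Homeomorph.trans_apply, target]
  · obtain ⟨hv, hw⟩ := (middle _ _).1 ((source p x).1 hx)
    have h₁ := h.tail p.1.1 x ((h.mem_iff _ x).2 hv) (m p - (v p.1.1).2.length + n)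
    have h₂ := h'.tail p.1.2 (φ x) hw (m p - (w' p.1.2).2.length + n)
    rw [← add_assoc, ← add_assoc, hmv] at h₁
    rw [← add_assoc, ← add_assoc, hmw] at h₂
    rw [length_initialWord, length_initialWord, Homeomorph.trans_apply]
    exact h₂.trans h₁

end IsCanonicalOn

theorem exists_isCanonicalOn {φ : shiftSet init term ι ≃ₜ shiftSet init term ι}
    (h : IsPiecewiseCanonical init term ι φ) :
    ∃ (k : ℕ) (w v : Fin k → I × List E), IsCanonicalOn φ w v := by
  obtain ⟨k, w, v, -, -, hw, hw', -, hv', -, hφ⟩ := h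
  have hmem (i) (x : shiftSet init term ι) (hx : x.1 ∈ cylinder init term ι (w i)) :
      (φ x).1 ∈ cylinder init term ι (v i) := by
    have hs := (φ x).2
    rw [hφ i x hx] at hs ⊢
    exact replacePrefix_mem_cylinder hs
  have hex (x : shiftSet init term ι) : ∃ i, x.1 ∈ cylinder init term ι (w i) :=
    Set.mem_iUnion.1 (hw.symm.subset x.2)
  refine ⟨k, w, v, fun x => ?_, fun i x => ⟨hmem i x, fun hx => ?_⟩, fun i x hx n => ?_⟩
  · obtain ⟨i, hi⟩ := hex x
    refine ⟨i, hi, fun j hj => ?_⟩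
    by_contra hne
    exact (hw' j i hne).le ⟨hj, hi⟩
  · obtain ⟨j, hj⟩ := hex x
    by_cases hne : j = i
    · exact hne ▸ hj
    · exact ((hv' j i hne).le ⟨hmem j x hj, hx⟩).elim
  · rw [hφ i x hx, replacePrefix_apply_add]

end EdgeShift

/-- The piecewise-canonical homeomorphisms of `Shift(Γ|Y)`
form a subgroup of the homeomorphism group: the identity is
piecewise-canonical, and piecewise-canonical homeomorphisms are closed under
composition and inverses. -/
theorem isPiecewiseCanonical_subgroup
    {V E I : Type*} [Finite V] [Finite E] [Finite I]
    (init term : E → V) (ι : I → V) :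
    IsPiecewiseCanonical init term ι (Homeomorph.refl _) ∧
    (∀ φ ψ : ↥(shiftSet init term ι) ≃ₜ ↥(shiftSet init term ι),
      IsPiecewiseCanonical init term ι φ → IsPiecewiseCanonical init term ι ψ →
      IsPiecewiseCanonical init term ι (φ.trans ψ)) ∧
    (∀ φ : ↥(shiftSet init term ι) ≃ₜ ↥(shiftSet init term ι),
      IsPiecewiseCanonical init term ι φ →
      IsPiecewiseCanonical init term ι φ.symm) := by
  refine ⟨EdgeShift.IsCanonicalOn.refl.isPiecewiseCanonical, fun φ ψ hφ hψ => ?_, fun φ hφ => ?_⟩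
  · obtain ⟨_, _, _, h⟩ := EdgeShift.exists_isCanonicalOn hφ
    obtain ⟨_, _, _, h'⟩ := EdgeShift.exists_isCanonicalOn hψ
    exact h.trans_isPiecewiseCanonical h'
  · obtain ⟨_, _, _, h⟩ := EdgeShift.exists_isCanonicalOn hφ
    exact h.symm.isPiecewiseCanonical
end

section
/- For each N ≥ 1, let ~_N be the smallest additive congruence on the commutative monoid of multisets over VΓ × {1, …, N} containing the relations R(c,n) for c ∈ VΓ and 1 ≤ n ≤ N. Then for any two multisets x, y over VΓ × {n ≥ 1} all of whose winding numbers are at most N, one has x ~ y if and only if x ~_N y. Consequently, the natural map from the commutative semigroup presented by the generators L(c,n) (c ∈ VΓ, 1 ≤ n ≤ N) and the relations R(c,n) (c ∈ VΓ, 1 ≤ n ≤ N) into the loops semigroup 𝕃 is injective, with image 𝕃_N; in particular, 𝕃_N is a finitely presented commutative semigroup. -/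
/-- The defining relations of the loops semigroup: for a vertex `c` and a
winding number `n`, the multiset `L(term e₁, n) + ⋯ + L(term e_k, n)` (where
`init⁻¹(c) = {e₁, …, e_k}`) is related to the singleton `L(c, n)`. -/
def loopRel {V E : Type*} [Fintype E] [DecidableEq V]
    (init term : E → V) (x y : Multiset (V × ℕ+)) : Prop :=
  ∃ (c : V) (n : ℕ+),
    x = (Finset.univ.filter fun e : E => init e = c).val.map
      (fun e => (term e, n)) ∧
    y = {(c, n)}

/-- The truncated defining relations: only the relations `R(c,n)` with
winding number `n ≤ N`. -/
def loopRelN {V E : Type*} [Fintype E] [DecidableEq V]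
    (init term : E → V) (N : ℕ+) (x y : Multiset (V × ℕ+)) : Prop :=
  ∃ (c : V) (n : ℕ+), n ≤ N ∧
    x = (Finset.univ.filter fun e : E => init e = c).val.map
      (fun e => (term e, n)) ∧
    y = {(c, n)}

/-- Discarding all loops of winding number exceeding `N` sends the congruence `~` into `~_N`. -/
theorem addConGen_loopRelN_filter {V E : Type*} [Fintype E] [DecidableEq V]
    {init term : E → V} (N : ℕ+) {x y : Multiset (V × ℕ+)}
    (h : addConGen (loopRel init term) x y) :
    addConGen (loopRelN init term N)
      (x.filter fun p => p.2 ≤ N) (y.filter fun p => p.2 ≤ N) := by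
  induction h with
  | of x y h =>
    obtain ⟨c, n, rfl, rfl⟩ := h
    by_cases hn : n ≤ N
    · rw [Multiset.filter_eq_self.2 (by simp [hn]), Multiset.filter_eq_self.2 (by simp [hn])]
      exact AddConGen.Rel.of _ _ ⟨c, n, hn, rfl, rfl⟩
    · have hn_lt : N < n := not_le.1 hn
      rw [Multiset.filter_eq_nil.2 (by simp [hn_lt]), Multiset.filter_eq_nil.2 (by simp [hn_lt])]
      exact AddCon.refl _ _
  | refl x => exact AddCon.refl _ _
  | symm _ ih => exact AddCon.symm _ ih
  | trans _ _ ih₁ ih₂ => exact AddCon.trans _ ih₁ ih₂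
  | add _ _ ih₁ ih₂ =>
    rw [Multiset.filter_add, Multiset.filter_add]
    exact AddCon.add _ ih₁ ih₂

/-- On multisets with winding numbers at most `N`, the congruences `~` and `~_N` agree. -/
theorem addConGen_loopRel_iff_loopRelN {V E : Type*} [Fintype E] [DecidableEq V]
    {init term : E → V} {N : ℕ+} {x y : Multiset (V × ℕ+)}
    (hx : ∀ p ∈ x, p.2 ≤ N) (hy : ∀ p ∈ y, p.2 ≤ N) :
    addConGen (loopRel init term) x y ↔ addConGen (loopRelN init term N) x y := by
  constructor
  · intro h
    simpa only [Multiset.filter_eq_self.2 hx, Multiset.filter_eq_self.2 hy] using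
      addConGen_loopRelN_filter N h
  · refine fun h => AddCon.addConGen_mono ?_ h
    rintro _ _ ⟨c, n, -, h₁, h₂⟩
    exact ⟨c, n, h₁, h₂⟩

/-- For multisets whose winding numbers are bounded by `N`,
the full congruence `~` coincides with the congruence `~_N` generated by the
finitely many relations `R(c,n)` with `n ≤ N`; consequently the natural map
from the finitely presented commutative semigroup on the generators `L(c,n)`,
`n ≤ N`, to the loops semigroup is injective (its image being `𝕃_N`). -/
theorem loops_semigroup_truncation
    {V E : Type*} [Finite V] [Fintype E] [DecidableEq V]
    (init term : E → V) (hsur : ∀ v : V, ∃ e, init e = v) (N : ℕ+) :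
    (∀ x y : Multiset (V × ℕ+),
      (∀ p ∈ x, p.2 ≤ N) → (∀ p ∈ y, p.2 ≤ N) →
      (addConGen (loopRel init term) x y ↔
        addConGen (loopRelN init term N) x y)) ∧
    (∀ x y : Multiset (V × ℕ+), x ≠ 0 → y ≠ 0 →
      (∀ p ∈ x, p.2 ≤ N) → (∀ p ∈ y, p.2 ≤ N) →
      ((x : (addConGen (loopRelN init term N)).Quotient) =
          (y : (addConGen (loopRelN init term N)).Quotient) ↔
        (x : (addConGen (loopRel init term)).Quotient) =
          (y : (addConGen (loopRel init term)).Quotient))) := by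
  refine ⟨fun x y hx hy => addConGen_loopRel_iff_loopRelN hx hy, fun x y _ _ hx hy => ?_⟩
  rw [AddCon.eq, AddCon.eq]
  exact (addConGen_loopRel_iff_loopRelN hx hy).symm
end

section
/- In the commutative semigroup presented by two generators r and b subject to the relations 3r + b = r and r + 3b = b, the elements r, b, and 2r + 2b are all equal; indeed each of them equals 5r + 5b. (Equivalently: in the quotient of the free commutative monoid on {r, b} by the smallest additive congruence containing (3r + b, r) and (r + 3b, b), the classes of r, b, 2r + 2b, and 5r + 5b all coincide.) -/
section Presentation

variable {M : Type*} [AddCommMonoid M] {r b : M}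

theorem five_nsmul_add_five_nsmul_eq_left (hr : 3 • r + b = r) (hb : r + 3 • b = b) :
    5 • r + 5 • b = r :=
  calc 5 • r + 5 • b = (r + 3 • b) + (4 • r + 2 • b) := by abel
    _ = b + (4 • r + 2 • b) := by rw [hb]
    _ = (r + 3 • b) + 3 • r := by abel
    _ = b + 3 • r := by rw [hb]
    _ = r := by rw [add_comm, hr]

theorem two_nsmul_add_two_nsmul_eq_five (hr : 3 • r + b = r) (hb : r + 3 • b = b) :
    2 • r + 2 • b = 5 • r + 5 • b :=
  calc 2 • r + 2 • b = b + (2 • r + b) := by abel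
    _ = (r + 3 • b) + (2 • r + b) := by rw [hb]
    _ = r + (2 • r + 4 • b) := by abel
    _ = (3 • r + b) + (2 • r + 4 • b) := by rw [hr]
    _ = 5 • r + 5 • b := by abel

end Presentation

/-- In the commutative semigroup presented by two generators
`r`, `b` (here `r = (0 : Fin 2)`, `b = (1 : Fin 2)`, and multisets over
`Fin 2` form the free commutative monoid) subject to the relations
`3r + b = r` and `r + 3b = b`, the classes of `r`, `b`, `2r + 2b` and
`5r + 5b` all coincide. -/
theorem non_confluent_loops_equal :
    let r : Multiset (Fin 2) := {0}
    let b : Multiset (Fin 2) := {1}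
    let rel : Multiset (Fin 2) → Multiset (Fin 2) → Prop := fun x y =>
      (x = 3 • r + b ∧ y = r) ∨ (x = r + 3 • b ∧ y = b)
    addConGen rel r b ∧
    addConGen rel r (2 • r + 2 • b) ∧
    addConGen rel r (5 • r + 5 • b) ∧
    addConGen rel b (5 • r + 5 • b) ∧
    addConGen rel (2 • r + 2 • b) (5 • r + 5 • b) := by
  intro r b rel
  have hr : 3 • (r : (addConGen rel).Quotient) + (b : (addConGen rel).Quotient) = r :=
    (AddCon.eq _).2 (AddConGen.Rel.of _ _ (Or.inl ⟨rfl, rfl⟩))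
  have hb : (r : (addConGen rel).Quotient) + 3 • (b : (addConGen rel).Quotient) = b :=
    (AddCon.eq _).2 (AddConGen.Rel.of _ _ (Or.inr ⟨rfl, rfl⟩))
  have hr5 : addConGen rel (5 • r + 5 • b) r :=
    (AddCon.eq _).1 (five_nsmul_add_five_nsmul_eq_left hr hb)
  have hb5 : addConGen rel (5 • r + 5 • b) b := by
    rw [add_comm]
    exact (AddCon.eq _).1 (five_nsmul_add_five_nsmul_eq_left
      ((add_comm _ _).trans hb) ((add_comm _ _).trans hr))
  have h2 : addConGen rel (2 • r + 2 • b) (5 • r + 5 • b) :=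
    (AddCon.eq _).1 (two_nsmul_add_two_nsmul_eq_five hr hb)
  exact ⟨(addConGen rel).trans ((addConGen rel).symm hr5) hb5, (addConGen rel).symm ((addConGen rel).trans h2 hr5),
    (addConGen rel).symm hr5, (addConGen rel).symm hb5, h2⟩
end
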